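/- arXiv:1305.0746 — 5 statements merged into one kernel-verified Lean document; each statement's English description precedes it below -/
import Mathlib

section
/- Let K be a quadratic étale algebra over a commutative unital ring k, with norm form n. Set t(a) = n(a,1) and ā = t(a)·1 − a for a ∈ K. Then the map η : K ⊗_k K → K ⊕ K determined by η(a ⊗ b) = (ab) ⊕ (ā b) is an isomorphism of K-algebras, where K ⊗_k K is a K-algebra via the second tensor factor and K ⊕ K carries componentwise operations and the K-algebra structure c ↦ (c,c). -/
/-- Dual bases of a finite projective module exist. -/
theorem Module.exists_dual_sum_smul_eq (R M : Type*) [CommRing R] [AddCommGroup M] [Module R M]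
    [Module.Finite R M] [Module.Projective R M] :
    ∃ (m : ℕ) (x : Fin m → M) (f : Fin m → Module.Dual R M), ∀ a, ∑ i, f i a • x i = a := by
  obtain ⟨m, p, g, -, -, h⟩ := Module.Finite.exists_comp_eq_id_of_projective R M
  refine ⟨m, fun i => p (Pi.single i 1), fun i => LinearMap.proj i ∘ₗ g, fun a => ?_⟩
  have ha : p (g a) = a := LinearMap.congr_fun h a
  conv_rhs => rw [← ha, ← Finset.univ_sum_single (g a), map_sum]
  refine Finset.sum_congr rfl fun i _ => ?_
  rw [LinearMap.comp_apply, LinearMap.proj_apply, ← map_smul, ← Pi.single_smul]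
  simp

/-- The trace of the identity, computed with a dual basis of a module whose localizations are
free of rank `d`, equals `d`. -/
theorem Module.sum_dual_apply_eq_natCast {R M ι : Type*} [CommRing R] [AddCommGroup M]
    [Module R M] [Module.Finite R M] [Fintype ι] (d : ℕ)
    (hrank : ∀ (p : Ideal R) [p.IsPrime],
      Module.Free (Localization.AtPrime p) (LocalizedModule p.primeCompl M) ∧
      Module.finrank (Localization.AtPrime p) (LocalizedModule p.primeCompl M) = d)
    (x : ι → M) (f : ι → Module.Dual R M) (h : ∀ a, ∑ i, f i a • x i = a) :
    ∑ i, f i (x i) = d := by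
  refine eq_of_localization_maximal (fun p _ => Localization.AtPrime p)
    (fun p _ => Algebra.linearMap R (Localization.AtPrime p)) _ _ fun p hp => ?_
  have := hp.isPrime
  obtain ⟨hfree, hd⟩ := hrank p
  let S := p.primeCompl
  let Rp := Localization.AtPrime p
  let Mp := LocalizedModule S M
  let j : M →ₗ[R] Mp := LocalizedModule.mkLinearMap S M
  let F : ι → Module.Dual Rp Mp := fun i =>
    IsLocalizedModule.mapExtendScalars S j (Algebra.linearMap R Rp) Rp (f i)
  have hF : ∀ i a, F i (j a) = algebraMap R Rp (f i a) := fun i a => by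
    simp [F, IsLocalizedModule.map_apply]
  have hid : ∑ i, (F i).smulRight (j (x i)) = LinearMap.id := by
    apply LinearMap.restrictScalars_injective R
    apply IsLocalizedModule.linearMap_ext S j j
    ext a
    simp only [LinearMap.comp_apply, LinearMap.restrictScalars_apply, LinearMap.sum_apply,
      LinearMap.smulRight_apply, hF, LinearMap.id_apply, algebraMap_smul]
    simp only [← map_smul, ← map_sum, h]
  have ht := congrArg (LinearMap.trace Rp Mp) hid
  rw [map_sum, LinearMap.trace_id, hd] at ht
  simp only [LinearMap.trace_smulRight, hF] at ht
  simpa using ht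

namespace QuadraticMap

variable {k K : Type*} [CommRing k] [CommRing K] [Algebra k K] (n : QuadraticForm k K)

/-- The conjugation `a ↦ n(a, 1) • 1 - a` attached to a quadratic form on an algebra. -/
def conj : K →ₗ[k] K :=
  (n.polarBilin.flip 1).smulRight 1 - LinearMap.id

theorem conj_apply (a : K) : n.conj a = n.polarBilin a 1 • (1 : K) - a := rfl

theorem polarBilin_comm (a b : K) : n.polarBilin a b = n.polarBilin b a :=
  polar_comm n a b

variable {n}

theorem polarBilin_mul_mul_right (hcomp : ∀ a b : K, n (a * b) = n a * n b) (a b c : K) :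
    n.polarBilin (a * c) (b * c) = n.polarBilin a b * n c := by
  simp only [polarBilin_apply_apply, polar, ← add_mul, hcomp]
  ring

theorem polarBilin_mul_add_polarBilin_mul (hcomp : ∀ a b : K, n (a * b) = n a * n b)
    (a c d : K) :
    n.polarBilin (a * c) d + n.polarBilin (a * d) c = n.polarBilin a 1 * n.polarBilin c d := by
  have h := polarBilin_mul_mul_right hcomp a 1 (c + d)
  have hc := polarBilin_mul_mul_right hcomp a 1 c
  have hd := polarBilin_mul_mul_right hcomp a 1 d
  have hn : n (c + d) = n c + n d + n.polarBilin c d := by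
    rw [polarBilin_apply_apply, polar]; ring
  simp only [one_mul, mul_add, map_add, LinearMap.add_apply, hn] at h hc hd
  linear_combination h - hc - hd

/-- Multiplication by the conjugate is adjoint to multiplication. -/
theorem polarBilin_mul_left (hcomp : ∀ a b : K, n (a * b) = n a * n b) (a c d : K) :
    n.polarBilin (a * c) d = n.polarBilin c (n.conj a * d) := by
  have h := polarBilin_mul_add_polarBilin_mul hcomp a c d
  rw [conj_apply, sub_mul, smul_mul_assoc, one_mul, map_sub, map_smul, smul_eq_mul,
    polarBilin_comm n c (a * d)]
  linear_combination h

theorem mul_self_eq (hcomp : ∀ a b : K, n (a * b) = n a * n b)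
    (hinj : Function.Injective n.polarBilin) (a : K) :
    a * a = n.polarBilin a 1 • a - n a • (1 : K) := by
  apply hinj
  ext d
  have h := polarBilin_mul_add_polarBilin_mul hcomp a a d
  have h' := polarBilin_mul_mul_right hcomp d 1 a
  rw [one_mul, mul_comm d a] at h'
  simp only [map_sub, map_smul, LinearMap.sub_apply, LinearMap.smul_apply, smul_eq_mul]
  rw [polarBilin_comm n 1 d]
  linear_combination h - h'

theorem polarBilin_smul_one (hcomp : ∀ a b : K, n (a * b) = n a * n b)
    (hinj : Function.Injective n.polarBilin) (a b : K) :
    n.polarBilin a b • (1 : K) = a * n.conj b + n.conj a * b := by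
  have ha := mul_self_eq hcomp hinj a
  have hb := mul_self_eq hcomp hinj b
  have h := mul_self_eq hcomp hinj (a + b)
  have hn : n (a + b) = n a + n b + n.polarBilin a b := by
    rw [polarBilin_apply_apply, polar]; ring
  simp only [map_add, LinearMap.add_apply, hn] at h
  simp only [conj_apply, Algebra.smul_def, map_add] at *
  linear_combination h - ha - hb

theorem conj_one (hcomp : ∀ a b : K, n (a * b) = n a * n b)
    (hinj : Function.Injective n.polarBilin) : n.conj 1 = 1 := by
  have h : n 1 • (1 : K) = 1 := by
    apply hinj
    ext d
    have h := polarBilin_mul_mul_right hcomp 1 d 1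
    simp only [mul_one] at h
    rw [map_smul, LinearMap.smul_apply, smul_eq_mul, mul_comm, ← h]
  have h1 := mul_self_eq hcomp hinj (1 : K)
  rw [h, one_mul] at h1
  rw [conj_apply, ← h1]

theorem conj_mul (hcomp : ∀ a b : K, n (a * b) = n a * n b)
    (hinj : Function.Injective n.polarBilin) (a b : K) :
    n.conj (a * b) = n.conj a * n.conj b := by
  have h := polarBilin_smul_one hcomp hinj a b
  have h' := congrArg (algebraMap k K) (polarBilin_mul_add_polarBilin_mul hcomp a b 1)
  simp only [conj_apply, Algebra.smul_def, map_add, map_mul, mul_one] at *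
  linear_combination h' - h

theorem conj_conj (hcomp : ∀ a b : K, n (a * b) = n a * n b)
    (hinj : Function.Injective n.polarBilin) (a : K) :
    n.conj (n.conj a) = a := by
  conv_lhs => rw [conj_apply n a, map_sub, map_smul, conj_one hcomp hinj, conj_apply]
  abel

/-- The conjugation of a composition form as an algebra endomorphism. -/
def conjAlgHom (hcomp : ∀ a b : K, n (a * b) = n a * n b)
    (hinj : Function.Injective n.polarBilin) : K →ₐ[k] K :=
  AlgHom.ofLinearMap n.conj (conj_one hcomp hinj) (conj_mul hcomp hinj)

open scoped TensorProduct

variable {ι : Type*} [Fintype ι] {x y : ι → K}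

theorem sum_polarBilin_smul_right (hinj : Function.Injective n.polarBilin)
    (hxy : ∀ a, ∑ i, n.polarBilin a (y i) • x i = a) (b : K) :
    ∑ i, n.polarBilin (x i) b • y i = b := by
  apply hinj
  ext a
  conv_rhs => rw [polarBilin_comm, ← hxy a]
  simp only [map_sum, map_smul, LinearMap.sum_apply, LinearMap.smul_apply, smul_eq_mul]
  exact Finset.sum_congr rfl fun i _ => by rw [polarBilin_comm n (y i) a, mul_comm]

theorem sum_mul_tmul (hcomp : ∀ a b : K, n (a * b) = n a * n b)
    (hinj : Function.Injective n.polarBilin)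
    (hxy : ∀ a, ∑ i, n.polarBilin a (y i) • x i = a) (a : K) :
    ∑ i, (a * x i) ⊗ₜ[k] y i = ∑ i, x i ⊗ₜ[k] (n.conj a * y i) := by
  calc ∑ i, (a * x i) ⊗ₜ[k] y i
      = ∑ i, ∑ j, x j ⊗ₜ[k] (n.polarBilin (a * x i) (y j) • y i) := by
        refine Finset.sum_congr rfl fun i _ => ?_
        conv_lhs => rw [← hxy (a * x i), TensorProduct.sum_tmul]
        simp only [TensorProduct.smul_tmul]
    _ = ∑ j, x j ⊗ₜ[k] (n.conj a * y j) := by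
        rw [Finset.sum_comm]
        refine Finset.sum_congr rfl fun j _ => ?_
        simp only [polarBilin_mul_left hcomp]
        rw [← TensorProduct.tmul_sum, sum_polarBilin_smul_right hinj hxy]

theorem sum_tmul_add_sum_conj_tmul (hinj : Function.Injective n.polarBilin)
    (hxy : ∀ a, ∑ i, n.polarBilin a (y i) • x i = a) :
    ∑ i, x i ⊗ₜ[k] y i + ∑ i, n.conj (x i) ⊗ₜ[k] y i = 1 := by
  have h (i : ι) : x i + n.conj (x i) = n.polarBilin (x i) 1 • (1 : K) := by
    rw [conj_apply, add_sub_cancel]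
  simp only [← Finset.sum_add_distrib, ← TensorProduct.add_tmul, h, TensorProduct.smul_tmul]
  rw [← TensorProduct.tmul_sum, sum_polarBilin_smul_right hinj hxy,
    Algebra.TensorProduct.one_def]

theorem sum_mul_add_sum_conj_mul (hinj : Function.Injective n.polarBilin)
    (hxy : ∀ a, ∑ i, n.polarBilin a (y i) • x i = a) :
    ∑ i, x i * y i + ∑ i, n.conj (x i) * y i = 1 := by
  simpa using congrArg (Algebra.TensorProduct.lmul' k) (sum_tmul_add_sum_conj_tmul hinj hxy)

theorem sum_mul_eq_zero (hcomp : ∀ a b : K, n (a * b) = n a * n b)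
    (hinj : Function.Injective n.polarBilin)
    (hxy : ∀ a, ∑ i, n.polarBilin a (y i) • x i = a)
    (htrace : ∑ i, n.polarBilin (x i) (y i) = 2) :
    ∑ i, x i * y i = 0 := by
  set e := ∑ i, x i * y i with he
  have hmul (a : K) : a * e = n.conj a * e := by
    have h := congrArg (Algebra.TensorProduct.lmul' k) (sum_mul_tmul hcomp hinj hxy a)
    simp only [map_sum, Algebra.TensorProduct.lmul'_apply_tmul] at h
    simp only [he, Finset.mul_sum]
    convert h using 2 <;> ring
  have hsum : ∑ i, n.conj (x i) * y i = 1 - e :=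
    eq_sub_of_add_eq' (sum_mul_add_sum_conj_mul hinj hxy)
  have hsum' : ∑ i, x i * n.conj (y i) = 1 - n.conj e := by
    have h := congrArg n.conj hsum
    simpa only [map_sum, map_sub, conj_mul hcomp hinj, conj_conj hcomp hinj,
      conj_one hcomp hinj] using h
  have htr : n.conj e + e = 0 := by
    have h := congrArg (fun c : k => c • (1 : K)) htrace
    simp only [Finset.sum_smul, polarBilin_smul_one hcomp hinj, Finset.sum_add_distrib, hsum,
      hsum', two_smul] at h
    linear_combination -h
  have hzero (a : K) : n.polarBilin e a • (1 : K) = 0 := by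
    rw [polarBilin_smul_one hcomp hinj]
    linear_combination a * htr - hmul a
  rw [← hxy e]
  refine Finset.sum_eq_zero fun i _ => ?_
  rw [← one_mul (x i), ← smul_mul_assoc, hzero, zero_mul]

/-- The algebra map `a ⊗ b ↦ (a b, ā b)`. -/
def tensorToProd (hcomp : ∀ a b : K, n (a * b) = n a * n b)
    (hinj : Function.Injective n.polarBilin) : K ⊗[k] K →ₐ[k] K × K :=
  Algebra.TensorProduct.lift ((AlgHom.id k K).prod (conjAlgHom hcomp hinj))
    ((AlgHom.id k K).prod (AlgHom.id k K)) fun _ _ => .all _ _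

theorem tensorToProd_tmul (hcomp : ∀ a b : K, n (a * b) = n a * n b)
    (hinj : Function.Injective n.polarBilin) (a b : K) :
    tensorToProd hcomp hinj (a ⊗ₜ[k] b) = (a * b, n.conj a * b) := rfl

theorem tensorToProd_bijective (hcomp : ∀ a b : K, n (a * b) = n a * n b)
    (hinj : Function.Injective n.polarBilin)
    (hxy : ∀ a, ∑ i, n.polarBilin a (y i) • x i = a)
    (htrace : ∑ i, n.polarBilin (x i) (y i) = 2) :
    Function.Bijective (tensorToProd hcomp hinj) := by
  set E : K ⊗[k] K := ∑ i, x i ⊗ₜ[k] y i with hE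
  have hEmul (a : K) : a ⊗ₜ[k] 1 * E = 1 ⊗ₜ[k] n.conj a * E := by
    simpa [hE, Finset.mul_sum] using sum_mul_tmul hcomp hinj hxy a
  have hE' : Algebra.TensorProduct.map (conjAlgHom hcomp hinj) (AlgHom.id k K) E = 1 - E := by
    rw [← sum_tmul_add_sum_conj_tmul hinj hxy, hE, add_sub_cancel_left, map_sum]
    rfl
  have hEmul' (a : K) : a ⊗ₜ[k] 1 * (1 - E) = 1 ⊗ₜ[k] a * (1 - E) := by
    have h := congrArg (Algebra.TensorProduct.map (conjAlgHom hcomp hinj) (AlgHom.id k K))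
      (hEmul (n.conj a))
    rw [map_mul, map_mul, hE', Algebra.TensorProduct.map_tmul, Algebra.TensorProduct.map_tmul,
      conj_conj hcomp hinj] at h
    change n.conj (n.conj a) ⊗ₜ[k] (1 : K) * _ = _ at h
    rw [conj_conj hcomp hinj] at h
    simpa using h
  have hηE : tensorToProd hcomp hinj E = (0, 1) := by
    have h0 := sum_mul_eq_zero hcomp hinj hxy htrace
    have h1 := sum_mul_add_sum_conj_mul hinj hxy
    rw [h0, zero_add] at h1
    simp only [hE, map_sum, tensorToProd_tmul]
    ext
    · simpa [Prod.fst_sum] using h0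
    · simpa [Prod.snd_sum] using h1
  let g (c : K × K) : K ⊗[k] K := 1 ⊗ₜ[k] c.1 * (1 - E) + 1 ⊗ₜ[k] c.2 * E
  refine Function.bijective_iff_has_inverse.mpr ⟨g, fun z => ?_, fun c => ?_⟩
  · induction z with
    | zero => simp [g]
    | add u v hu hv =>
      conv_rhs => rw [← hu, ← hv]
      rw [map_add]
      simp only [g, Prod.fst_add, Prod.snd_add, TensorProduct.tmul_add]
      ring
    | tmul a b =>
      have hab (u v : K) : (1 : K) ⊗ₜ[k] (u * v) = 1 ⊗ₜ[k] u * 1 ⊗ₜ[k] v := by simp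
      have hab' : a ⊗ₜ[k] b = a ⊗ₜ[k] 1 * 1 ⊗ₜ[k] b := by simp
      simp only [g, tensorToProd_tmul, hab]
      rw [hab']
      linear_combination (-1 ⊗ₜ[k] b) * hEmul a - 1 ⊗ₜ[k] b * hEmul' a
  · simp only [g, map_add, map_mul, map_sub, map_one, hηE, tensorToProd_tmul,
      conj_one hcomp hinj]
    ext <;> simp

end QuadraticMap

open scoped TensorProduct in
/-- If `K` is a quadratic étale algebra over `k` with norm form `n`,
`t(a) = n(a,1)` and `ā = t(a)·1 − a`, then `a ⊗ b ↦ (ab) ⊕ (āb)` defines an isomorphism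
of `K`-algebras `K ⊗_k K ≅ K ⊕ K`, where `K ⊗_k K` is a `K`-algebra via the second
tensor factor and `K ⊕ K` has componentwise operations and diagonal `K`-structure. -/
theorem quadratic_etale_tensor_split
    (k : Type*) [CommRing k] (K : Type*) [CommRing K] [Algebra k K]
    [Module.Finite k K] [Module.Projective k K]
    (hrank : ∀ (p : Ideal k) [p.IsPrime],
      Module.Free (Localization.AtPrime p) (LocalizedModule p.primeCompl K) ∧
      Module.finrank (Localization.AtPrime p) (LocalizedModule p.primeCompl K) = 2)
    (n : QuadraticForm k K)
    (hnonsing : Function.Bijective (QuadraticMap.polarBilin n))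
    (hcomp : ∀ a b : K, n (a * b) = n a * n b) :
    letI : Algebra K (K ⊗[k] K) :=
      (Algebra.TensorProduct.includeRight (R := k) (A := K) (B := K)).toRingHom.toAlgebra
    ∃ η : (K ⊗[k] K) ≃ₐ[K] K × K,
      ∀ a b : K, η (a ⊗ₜ[k] b) = (a * b, ((n.polarBilin a 1) • (1 : K) - a) * b) := by
  obtain ⟨m, x, f, hf⟩ := Module.exists_dual_sum_smul_eq k K
  choose y hy using fun i => hnonsing.surjective (f i)
  have hfy (i : Fin m) (a : K) : f i a = n.polarBilin a (y i) := by
    rw [← hy, QuadraticMap.polarBilin_comm]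
  have htrace := Module.sum_dual_apply_eq_natCast 2 hrank x f hf
  simp only [hfy, Nat.cast_ofNat] at hf htrace
  let e := RingEquiv.ofBijective _
    (QuadraticMap.tensorToProd_bijective hcomp hnonsing.injective hf htrace)
  let : Algebra K (K ⊗[k] K) :=
    (Algebra.TensorProduct.includeRight (R := k) (A := K) (B := K)).toRingHom.toAlgebra
  refine ⟨AlgEquiv.ofRingEquiv (f := e) fun c => ?_, fun a b => rfl⟩
  change QuadraticMap.tensorToProd hcomp hnonsing.injective (1 ⊗ₜ[k] c) = (c, c)
  rw [QuadraticMap.tensorToProd_tmul, QuadraticMap.conj_one hcomp hnonsing.injective, one_mul]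
end

section
/- Let M be a module over a commutative unital ring k, let 1 ≤ l ≤ n, let φ₁,…,φ_l ∈ M*, and let m₁,…,m_n ∈ M. Let S be the set of permutations σ of {1,…,n} satisfying σ(l+1) < σ(l+2) < ⋯ < σ(n). Then in Λ(M): (φ_l φ_{l−1} ⋯ φ₁)·(m₁ m₂ ⋯ m_n) = Σ_{σ ∈ S} sgn(σ) · φ₁(m_{σ(1)}) ⋯ φ_l(m_{σ(l)}) · m_{σ(l+1)} ⋯ m_{σ(n)}. -/
open ExteriorAlgebra

/-- The algebra homomorphism `Δ : Λ(M*) → End(Λ(M))` extending the contraction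
`φ ↦ Δ_φ`, so that `Δ(ξ)(x) = ξ·x`. -/
noncomputable def extDelta (R : Type*) [CommRing R] (M : Type*) [AddCommGroup M] [Module R M] :
    ExteriorAlgebra R (Module.Dual R M) →ₐ[R] Module.End R (ExteriorAlgebra R M) :=
  ExteriorAlgebra.lift R ⟨CliffordAlgebra.contractLeft (Q := (0 : QuadraticForm R M)),
    fun d => LinearMap.ext fun x => CliffordAlgebra.contractLeft_contractLeft d x⟩

/-- The contraction of a product of vectors, expanded along the vectors. -/
theorem contractLeft_ιMulti {R : Type*} [CommRing R] {M : Type*} [AddCommGroup M] [Module R M]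
    (d : Module.Dual R M) {n : ℕ} (m : Fin (n + 1) → M) :
    CliffordAlgebra.contractLeft (Q := (0 : QuadraticForm R M)) d (ιMulti R (n + 1) m) =
      ∑ j : Fin (n + 1), ((-1 : ℤ) ^ (j : ℕ)) • (d (m j) • ιMulti R n (m ∘ j.succAbove)) := by
  have contract_cons (v : M) (x : ExteriorAlgebra R M) :
      CliffordAlgebra.contractLeft (Q := (0 : QuadraticForm R M)) d (ι R v * x) =
        d v • x - ι R v * CliffordAlgebra.contractLeft (Q := (0 : QuadraticForm R M)) d x :=
    CliffordAlgebra.contractLeft_ι_mul d v x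
  induction n with
  | zero =>
    rw [ιMulti_succ_apply, contract_cons, ιMulti_zero_apply,
      CliffordAlgebra.contractLeft_one (Q := (0 : QuadraticForm R M)) d]
    simp
  | succ n ih =>
    rw [ιMulti_succ_apply, contract_cons, ih, Fin.sum_univ_succ (n := n + 1), Finset.mul_sum,
      sub_eq_add_neg, ← Finset.sum_neg_distrib]
    congr 1
    · simp only [Fin.val_zero, pow_zero, one_smul]
      rfl
    · refine Finset.sum_congr rfl fun j _ => ?_
      rw [ιMulti_succ_apply, Fin.val_succ, pow_succ, mul_neg_one, neg_smul, mul_smul_comm,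
        mul_smul_comm]
      simp [Function.comp_def, Matrix.vecTail]

/-- The permutation of `Fin (n + 1)` sending `0` to `j` and `i.succ` to `j.succAbove (τ i)`. -/
def permCons {n : ℕ} (j : Fin (n + 1)) (τ : Equiv.Perm (Fin n)) : Equiv.Perm (Fin (n + 1)) :=
  j.cycleRange.symm * Equiv.Perm.decomposeFin.symm (0, τ)

@[simp]
theorem permCons_zero {n : ℕ} (j : Fin (n + 1)) (τ : Equiv.Perm (Fin n)) :
    permCons j τ 0 = j := by
  simp [permCons]

@[simp]
theorem permCons_succ {n : ℕ} (j : Fin (n + 1)) (τ : Equiv.Perm (Fin n)) (i : Fin n) :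
    permCons j τ i.succ = j.succAbove (τ i) := by
  simp [permCons]

theorem sign_permCons {n : ℕ} (j : Fin (n + 1)) (τ : Equiv.Perm (Fin n)) :
    Equiv.Perm.sign (permCons j τ) = (-1) ^ (j : ℕ) * Equiv.Perm.sign τ := by
  simp [permCons, Fin.sign_cycleRange]

theorem permCons_bijective (n : ℕ) :
    Function.Bijective fun p : Fin (n + 1) × Equiv.Perm (Fin n) => permCons p.1 p.2 := by
  rw [Fintype.bijective_iff_injective_and_card]
  refine ⟨?_, (Fintype.card_congr Equiv.Perm.decomposeFin).symm⟩
  rintro ⟨j, τ⟩ ⟨j', τ'⟩ h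
  obtain rfl : j = j' := by simpa using Equiv.congr_fun h 0
  refine Prod.ext rfl (Equiv.ext fun i => ?_)
  simpa using Equiv.congr_fun h i.succ

/-- `σ` is increasing on the indices that are at least `l`. -/
abbrev IncreasingFrom {n : ℕ} (l : ℕ) (σ : Equiv.Perm (Fin n)) : Prop :=
  ∀ i j : Fin n, l ≤ (i : ℕ) → (i : ℕ) < (j : ℕ) → ((σ i : ℕ) < (σ j : ℕ))

theorem increasingFrom_permCons {n : ℕ} (l : ℕ) (j : Fin (n + 1)) (τ : Equiv.Perm (Fin n)) :
    IncreasingFrom (l + 1) (permCons j τ) ↔ IncreasingFrom l τ := by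
  simp [IncreasingFrom, Fin.forall_fin_succ]

theorem increasingFrom_zero_iff {n : ℕ} (σ : Equiv.Perm (Fin n)) :
    IncreasingFrom 0 σ ↔ σ = 1 := by
  refine ⟨fun h => ?_, fun h => by simp [h, IncreasingFrom]⟩
  have hσ : StrictMono σ := fun i j hij => h i j (Nat.zero_le _) hij
  have := Subsingleton.elim (hσ.orderIsoOfSurjective σ σ.surjective) (OrderIso.refl (Fin n))
  exact Equiv.ext fun i => congrArg (fun e : Fin n ≃o Fin n => e i) this

theorem extDelta_ofFn_prod_apply_ιMulti {R : Type*} [CommRing R] {M : Type*} [AddCommGroup M]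
    [Module R M] (l d n : ℕ) (h : l + d = n) (φ : Fin l → Module.Dual R M) (m : Fin n → M) :
    extDelta R M (List.ofFn fun i : Fin l => ι R (φ i.rev)).prod (ιMulti R n m) =
      ∑ σ : Equiv.Perm (Fin n) with IncreasingFrom l σ,
        (Equiv.Perm.sign σ : ℤ) •
          ((∏ i : Fin l, φ i (m (σ (Fin.castLE (h ▸ Nat.le_add_right l d) i)))) •
            ιMulti R d fun t => m (σ (Fin.cast h (Fin.natAdd l t)))) := by
  induction l generalizing n with
  | zero =>
    obtain rfl : d = n := by omega
    simp [increasingFrom_zero_iff, Finset.filter_eq']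
  | succ l ih =>
    obtain ⟨n, rfl⟩ : ∃ k, n = k + 1 := ⟨l + d, by omega⟩
    have hn : l + d = n := by omega
    have hφ : extDelta R M (ι R (φ 0)) =
        CliffordAlgebra.contractLeft (Q := (0 : QuadraticForm R M)) (φ 0) :=
      ExteriorAlgebra.lift_ι_apply _ _ _ _
    rw [List.ofFn_succ', List.concat_eq_append, List.prod_append, List.prod_singleton, map_mul,
      Module.End.mul_apply, Fin.rev_last, hφ, contractLeft_ιMulti, map_sum, Finset.sum_filter,
      ← (permCons_bijective n).sum_comp, Fintype.sum_prod_type]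
    refine Finset.sum_congr rfl fun j _ => ?_
    simp only [Fin.rev_castSucc]
    rw [map_zsmul, map_smul, ih n hn (fun i => φ i.succ), Finset.sum_filter, Finset.smul_sum,
      Finset.smul_sum]
    refine Finset.sum_congr rfl fun τ _ => ?_
    have hcast (t : Fin d) : Fin.cast h (Fin.natAdd (l + 1) t) =
        (Fin.cast hn (Fin.natAdd l t)).succ := Fin.ext (by simp; omega)
    simp only [increasingFrom_permCons, sign_permCons, Fin.prod_univ_succ, hcast, permCons_succ,
      Fin.castLE_zero, Fin.castLE_succ, permCons_zero, Function.comp_apply]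
    split_ifs
    · rw [smul_comm (φ 0 (m j)), smul_smul, smul_smul]
      simp
    · simp

/-- For `1 ≤ l ≤ n`, `φ₁,…,φ_l ∈ M*`, `m₁,…,m_n ∈ M` and `S` the set of
permutations `σ` of `{1,…,n}` with `σ(l+1) < ⋯ < σ(n)`, one has
`(φ_l⋯φ₁)·(m₁⋯m_n) = Σ_{σ∈S} sgn(σ) φ₁(m_{σ1})⋯φ_l(m_{σl}) m_{σ(l+1)}⋯m_{σn}`. -/
theorem contraction_sum_formula
    (R : Type*) [CommRing R] (M : Type*) [AddCommGroup M] [Module R M]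
    (l n : ℕ) (hl : 1 ≤ l) (hln : l ≤ n)
    (φ : Fin l → Module.Dual R M) (m : Fin n → M) :
    extDelta R M ((List.ofFn fun i : Fin l => ι R (φ i.rev)).prod)
        ((List.ofFn fun j : Fin n => ι R (m j)).prod) =
      ∑ σ ∈ Finset.univ.filter (fun σ : Equiv.Perm (Fin n) =>
          ∀ i j : Fin n, l ≤ (i : ℕ) → (i : ℕ) < (j : ℕ) → ((σ i : ℕ) < (σ j : ℕ))),
        (Equiv.Perm.sign σ : ℤ) •
          ((∏ i : Fin l, φ i (m (σ (Fin.castLE hln i)))) •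
            (List.ofFn fun t : Fin (n - l) =>
              ι R (m (σ (Fin.cast (by omega) (Fin.natAdd l t))))).prod) := by
  simpa only [ιMulti_apply] using
    extDelta_ofFn_prod_apply_ιMulti l (n - l) n (by omega) φ m
end

section
/- Let M be a finitely generated projective module over a commutative unital ring k, let x ∈ Λ_l(M) and ξ ∈ Λ_l(M*). Then x·ξ = ξ·x as scalars: there exists c ∈ k such that Δ(ξ)(x) = c·1 in Λ(M) and Δ'(x)(ξ) = c·1 in Λ(M*). -/
open ExteriorAlgebra

/-- The algebra homomorphism `Δ' : Λ(M) → End(Λ(M*))` obtained from contraction via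
the canonical map `M → M**`, so that `Δ'(x)(ξ) = x·ξ`. -/
noncomputable def extDelta' (R : Type*) [CommRing R] (M : Type*) [AddCommGroup M] [Module R M] :
    ExteriorAlgebra R M →ₐ[R] Module.End R (ExteriorAlgebra R (Module.Dual R M)) :=
  ExteriorAlgebra.lift R
    ⟨(CliffordAlgebra.contractLeft
        (Q := (0 : QuadraticForm R (Module.Dual R M)))).comp (Module.Dual.eval R M),
      fun _ => LinearMap.ext fun ξ => CliffordAlgebra.contractLeft_contractLeft _ ξ⟩

section Contraction

open CliffordAlgebra (contractLeft involute)

variable {R M N : Type*} [CommRing R] [AddCommGroup M] [Module R M] [AddCommGroup N] [Module R N]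

/-- Contraction is a graded derivation with respect to right multiplication by a vector. -/
theorem CliffordAlgebra.contractLeft_mul_ι {Q : QuadraticForm R M} (d : Module.Dual R M)
    (b : CliffordAlgebra Q) (a : M) :
    contractLeft d (b * CliffordAlgebra.ι Q a) =
      contractLeft d b * CliffordAlgebra.ι Q a + d a • involute b := by
  induction b using CliffordAlgebra.left_induction with
  | algebraMap r =>
    rw [contractLeft_algebraMap_mul, contractLeft_ι, contractLeft_algebraMap, zero_mul, zero_add,
      AlgHom.commutes, Algebra.smul_def, Algebra.commutes]
  | add x y hx hy => simp only [add_mul, map_add, hx, hy, smul_add]; abel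
  | ι_mul x m hx =>
    simp only [mul_assoc, contractLeft_ι_mul, hx, map_mul, involute_ι, sub_mul, mul_add,
      smul_mul_assoc, mul_smul_comm, neg_mul, smul_neg]
    abel

theorem CliffordAlgebra.involute_contractLeft {Q : QuadraticForm R M} (d : Module.Dual R M)
    (b : CliffordAlgebra Q) :
    involute (contractLeft d b) = -contractLeft d (involute b) := by
  induction b using CliffordAlgebra.left_induction with
  | algebraMap r => simp
  | add x y hx hy => simp only [map_add, hx, hy, neg_add]
  | ι_mul x m hx =>
    simp only [contractLeft_ι_mul, hx, map_mul, map_sub, map_smul, involute_ι, neg_mul, mul_neg,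
      map_neg]
    abel

namespace ExteriorAlgebra

/-- The action of `Λ(N)` on `Λ(M)` by contractions induced by a pairing `g` of `N` with `M`. -/
noncomputable def contractionHom (g : N →ₗ[R] Module.Dual R M) :
    ExteriorAlgebra R N →ₐ[R] Module.End R (ExteriorAlgebra R M) :=
  lift R ⟨(contractLeft (Q := (0 : QuadraticForm R M))).comp g,
    fun _ => LinearMap.ext fun x => CliffordAlgebra.contractLeft_contractLeft _ x⟩

@[simp]
theorem contractionHom_ι (g : N →ₗ[R] Module.Dual R M) (n : N) (x : ExteriorAlgebra R M) :
    contractionHom g (ι R n) x = contractLeft (Q := (0 : QuadraticForm R M)) (g n) x := by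
  simp [contractionHom]

theorem contractLeft_mem_exteriorPower (d : Module.Dual R M) {n : ℕ} {x : ExteriorAlgebra R M}
    (hx : x ∈ ⋀[R]^(n + 1) M) :
    contractLeft (Q := (0 : QuadraticForm R M)) d x ∈ ⋀[R]^n M := by
  induction n generalizing x with
  | zero =>
    rw [exteriorPower, zero_add, pow_one] at hx
    obtain ⟨m, rfl⟩ := hx
    rw [exteriorPower, pow_zero]
    exact Submodule.mem_one.mpr ⟨d m, (CliffordAlgebra.contractLeft_ι 0 d m).symm⟩
  | succ n ih =>
    rw [exteriorPower, pow_succ'] at hx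
    refine Submodule.mul_induction_on hx ?_ fun x y hx hy => ?_
    · rintro _ ⟨m, rfl⟩ y hy
      rw [show ι R m = CliffordAlgebra.ι 0 m from rfl, CliffordAlgebra.contractLeft_ι_mul]
      refine Submodule.sub_mem _ (Submodule.smul_mem _ _ hy) ?_
      rw [exteriorPower, pow_succ']
      exact Submodule.mul_mem_mul ⟨m, rfl⟩ (ih hy)
    · rw [map_add]
      exact Submodule.add_mem _ hx hy

theorem contractionHom_mem_exteriorPower (g : N →ₗ[R] Module.Dual R M) {l n : ℕ}
    {ξ : ExteriorAlgebra R N} (hξ : ξ ∈ ⋀[R]^l N)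
    {x : ExteriorAlgebra R M} (hx : x ∈ ⋀[R]^(n + l) M) :
    contractionHom g ξ x ∈ ⋀[R]^n M := by
  induction l generalizing ξ x with
  | zero =>
    rw [exteriorPower, pow_zero] at hξ
    obtain ⟨r, rfl⟩ := Submodule.mem_one.mp hξ
    rw [AlgHom.commutes, Module.algebraMap_end_apply]
    exact Submodule.smul_mem _ _ hx
  | succ l ih =>
    rw [exteriorPower, pow_succ] at hξ
    refine Submodule.mul_induction_on hξ ?_ fun ξ η hξ hη => ?_
    · rintro ξ hξ _ ⟨m, rfl⟩
      rw [map_mul, Module.End.mul_apply, contractionHom_ι]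
      exact ih hξ (contractLeft_mem_exteriorPower _ hx)
    · rw [map_add, LinearMap.add_apply]
      exact Submodule.add_mem _ hξ hη

theorem algebraMap_algebraMapInv_of_mem {x : ExteriorAlgebra R M} (hx : x ∈ ⋀[R]^0 M) :
    algebraMap R _ (algebraMapInv x) = x := by
  rw [exteriorPower, pow_zero] at hx
  obtain ⟨r, rfl⟩ := Submodule.mem_one.mp hx
  rw [algebraMap_leftInverse M r]

@[simp]
theorem algebraMapInv_ι (m : M) : algebraMapInv (ι R m) = 0 := by
  simp [algebraMapInv]

theorem algebraMapInv_involute (x : ExteriorAlgebra R M) :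
    algebraMapInv (involute (Q := (0 : QuadraticForm R M)) x) = algebraMapInv x := by
  have : algebraMapInv.comp (involute (Q := (0 : QuadraticForm R M))) =
      (algebraMapInv : ExteriorAlgebra R M →ₐ[R] R) := by
    ext m
    change algebraMapInv (involute (CliffordAlgebra.ι 0 m)) = algebraMapInv (ι R m)
    rw [CliffordAlgebra.involute_ι, map_neg]
    change -algebraMapInv (ι R m) = _
    simp
  exact DFunLike.congr_fun this x

theorem contractionHom_apply_one (g : N →ₗ[R] Module.Dual R M) (ξ : ExteriorAlgebra R N) :
    contractionHom g ξ 1 = algebraMap R _ (algebraMapInv ξ) := by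
  induction ξ using CliffordAlgebra.right_induction with
  | algebraMap r =>
    change contractionHom g (algebraMap R (ExteriorAlgebra R N) r) 1 =
      algebraMap R _ (algebraMapInv (algebraMap R (ExteriorAlgebra R N) r))
    rw [algebraMap_leftInverse N r, AlgHom.commutes, Module.algebraMap_end_apply,
      Algebra.algebraMap_eq_smul_one]
  | add ξ η hξ hη => simp only [map_add, LinearMap.add_apply, hξ, hη]
  | mul_ι n ξ _ =>
    change contractionHom g (ξ * ι R n) 1 = algebraMap R _ (algebraMapInv (ξ * ι R n))
    rw [map_mul, Module.End.mul_apply, contractionHom_ι, CliffordAlgebra.contractLeft_one]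
    simp

theorem contractionHom_involute (g : N →ₗ[R] Module.Dual R M) (ξ : ExteriorAlgebra R N)
    (x : ExteriorAlgebra R M) :
    contractionHom g ξ (involute (Q := (0 : QuadraticForm R M)) x) =
      involute (Q := (0 : QuadraticForm R M))
        (contractionHom g (involute (Q := (0 : QuadraticForm R N)) ξ) x) := by
  induction ξ using CliffordAlgebra.right_induction generalizing x with
  | algebraMap r =>
    rw [AlgHom.commutes involute]
    change contractionHom g (algebraMap R (ExteriorAlgebra R N) r) _ =
      involute (contractionHom g (algebraMap R (ExteriorAlgebra R N) r) x)
    rw [AlgHom.commutes, Module.algebraMap_end_apply, Module.algebraMap_end_apply, map_smul]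
  | add ξ η hξ hη => simp only [map_add, LinearMap.add_apply, hξ, hη]
  | mul_ι n ξ hξ =>
    rw [map_mul involute, CliffordAlgebra.involute_ι, mul_neg, map_neg]
    change contractionHom g (ξ * ι R n) _ =
      involute ((-contractionHom g (involute (Q := (0 : QuadraticForm R N)) ξ * ι R n)) x)
    rw [map_mul, map_mul, Module.End.mul_apply, LinearMap.neg_apply, Module.End.mul_apply,
      contractionHom_ι, contractionHom_ι, ← map_neg, ← hξ, map_neg,
      CliffordAlgebra.involute_contractLeft, neg_neg]

theorem algebraMapInv_contractionHom_mul_ι (g : N →ₗ[R] Module.Dual R M)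
    (ξ : ExteriorAlgebra R N) (n : N) (x : ExteriorAlgebra R M) :
    algebraMapInv (contractionHom g.flip x (ξ * ι R n)) =
      algebraMapInv (contractionHom g.flip
        (contractLeft (Q := (0 : QuadraticForm R M)) (g n) x) ξ) := by
  induction x using CliffordAlgebra.right_induction generalizing ξ with
  | algebraMap r =>
    rw [CliffordAlgebra.contractLeft_algebraMap, map_zero, LinearMap.zero_apply, map_zero]
    change algebraMapInv (contractionHom g.flip (algebraMap R (ExteriorAlgebra R M) r) _) = 0
    rw [AlgHom.commutes, Module.algebraMap_end_apply]
    simp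
  | add x y hx hy => simp only [map_add, LinearMap.add_apply, hx, hy]
  | mul_ι m x hx =>
    rw [CliffordAlgebra.contractLeft_mul_ι, map_add, map_smul]
    change algebraMapInv (contractionHom g.flip (x * ι R m) _) =
      algebraMapInv ((contractionHom g.flip (contractLeft (g n) x * ι R m) + _) ξ)
    rw [map_mul (contractionHom _), map_mul (contractionHom _), Module.End.mul_apply,
      LinearMap.add_apply, LinearMap.smul_apply,
      Module.End.mul_apply, contractionHom_ι, contractionHom_ι]
    have h := CliffordAlgebra.contractLeft_mul_ι (Q := (0 : QuadraticForm R N)) (g.flip m) ξ n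
    refine (congrArg _ (congrArg _ h)).trans ?_
    rw [map_add, map_add, map_add, map_smul, map_smul, map_smul, contractionHom_involute,
      algebraMapInv_involute, LinearMap.flip_apply]
    exact congrArg (· + _) (hx _)

theorem algebraMapInv_contractionHom_flip (g : N →ₗ[R] Module.Dual R M)
    (ξ : ExteriorAlgebra R N) (x : ExteriorAlgebra R M) :
    algebraMapInv (contractionHom g ξ x) = algebraMapInv (contractionHom g.flip x ξ) := by
  induction ξ using CliffordAlgebra.right_induction generalizing x with
  | algebraMap r =>
    change algebraMapInv (contractionHom g (algebraMap R (ExteriorAlgebra R N) r) x) =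
      algebraMapInv (contractionHom g.flip x (algebraMap R (ExteriorAlgebra R N) r))
    rw [AlgHom.commutes, Module.algebraMap_end_apply, Algebra.algebraMap_eq_smul_one, map_smul,
      map_smul, map_smul, contractionHom_apply_one, algebraMap_leftInverse N]
  | add ξ η hξ hη => simp only [map_add, LinearMap.add_apply, hξ, hη]
  | mul_ι n ξ hξ =>
    change algebraMapInv (contractionHom g (ξ * ι R n) x) =
      algebraMapInv (contractionHom g.flip x (ξ * ι R n))
    rw [map_mul, Module.End.mul_apply, contractionHom_ι, hξ, algebraMapInv_contractionHom_mul_ι]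

end ExteriorAlgebra

end Contraction

/-- For a finitely generated projective module `M`, `x ∈ Λ_l(M)` and
`ξ ∈ Λ_l(M*)`, the contractions `ξ·x` and `x·ξ` are equal scalars: there is `c ∈ k`
with `Δ(ξ)(x) = c·1` in `Λ(M)` and `Δ'(x)(ξ) = c·1` in `Λ(M*)`. -/
theorem contraction_symm
    (R : Type*) [CommRing R] (M : Type*) [AddCommGroup M] [Module R M]
    [Module.Finite R M] [Module.Projective R M] (l : ℕ)
    (x : ExteriorAlgebra R M) (hx : x ∈ ⋀[R]^l M)
    (ξ : ExteriorAlgebra R (Module.Dual R M)) (hξ : ξ ∈ ⋀[R]^l (Module.Dual R M)) :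
    ∃ c : R, extDelta R M ξ x = algebraMap R (ExteriorAlgebra R M) c ∧
      extDelta' R M x ξ = algebraMap R (ExteriorAlgebra R (Module.Dual R M)) c := by
  have hΔ : extDelta R M = contractionHom LinearMap.id := rfl
  have hΔ' : extDelta' R M = contractionHom (LinearMap.flip LinearMap.id) := rfl
  rw [hΔ, hΔ']
  refine ⟨algebraMapInv (contractionHom LinearMap.id ξ x), ?_, ?_⟩
  · exact (algebraMap_algebraMapInv_of_mem
      (contractionHom_mem_exteriorPower _ hξ (by rwa [zero_add]))).symm
  · rw [algebraMapInv_contractionHom_flip]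
    exact (algebraMap_algebraMapInv_of_mem
      (contractionHom_mem_exteriorPower _ hx (by rwa [zero_add]))).symm
end

section
/- Let M be a finitely generated projective module over a commutative unital ring k, let x ∈ Λ_l(M), let φ₁,…,φ_l ∈ M*, and let m ∈ M. Then e(x, φ₁φ₂⋯φ_l)(m) = Σ_{σ ∈ C_l} sgn(σ) · φ_{σ(1)}(m) · ((φ_{σ(2)} ⋯ φ_{σ(l)})·x), where C_l is the cyclic subgroup of the symmetric group S_l generated by the cycle (1,2,…,l), and each element (φ_{σ(2)} ⋯ φ_{σ(l)})·x lies in Λ₁(M) = M. -/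
open ExteriorAlgebra

section ListProducts

variable {R : Type*} [CommRing R] {M : Type*} [AddCommGroup M] [Module R M]

theorem ExteriorAlgebra.ι_mul_prod_map_ι (v : M) (L : List M) :
    ι R v * (L.map (ι R)).prod = (-1 : R) ^ L.length • ((L.map (ι R)).prod * ι R v) := by
  induction L with
  | nil => simp
  | cons w L ih =>
    have h : ι R v * ι R w = -(ι R w * ι R v) :=
      eq_neg_of_add_eq_zero_left (ι_add_mul_swap v w)
    simp only [List.map_cons, List.prod_cons, List.length_cons]
    rw [← mul_assoc, h, neg_mul, mul_assoc, ih, mul_smul_comm, pow_succ, mul_neg_one, neg_smul,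
      mul_assoc]

theorem ExteriorAlgebra.prod_map_ι_mul_prod_map_ι (K L : List M) :
    (K.map (ι R)).prod * (L.map (ι R)).prod =
      (-1 : R) ^ (K.length * L.length) • ((L.map (ι R)).prod * (K.map (ι R)).prod) := by
  induction K with
  | nil => simp
  | cons v K ih =>
    simp only [List.map_cons, List.prod_cons, List.length_cons]
    rw [mul_assoc, ih, mul_smul_comm, ← mul_assoc, ι_mul_prod_map_ι, smul_mul_assoc, smul_smul,
      mul_assoc, ← pow_add, add_mul, one_mul]

theorem ExteriorAlgebra.contractLeft_prod_map_ι (d : Module.Dual R M) (L : List M) :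
    CliffordAlgebra.contractLeft (Q := (0 : QuadraticForm R M)) d ((L.map (ι R)).prod) =
      ∑ t : Fin L.length, (-1 : R) ^ (t : ℕ) • d L[t] •
        (((L.take t).map (ι R)).prod * ((L.drop (t + 1)).map (ι R)).prod) := by
  induction L with
  | nil => simp
  | cons v L ih =>
    rw [List.map_cons, List.prod_cons]
    refine (CliffordAlgebra.contractLeft_ι_mul (Q := (0 : QuadraticForm R M)) d v _).trans ?_
    rw [ih]
    simp only [List.length_cons]
    rw [Fin.sum_univ_succ, sub_eq_add_neg]
    congr 1
    · simp
    · rw [Finset.mul_sum, ← Finset.sum_neg_distrib]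
      refine Finset.sum_congr rfl fun t _ => ?_
      rw [mul_smul_comm, mul_smul_comm, ← neg_smul]
      simp [pow_succ, mul_assoc]

theorem ExteriorAlgebra.contractLeft_prod_map_ι_rotate (d : Module.Dual R M) (L : List M) :
    CliffordAlgebra.contractLeft (Q := (0 : QuadraticForm R M)) d ((L.map (ι R)).prod) =
      ∑ t : Fin L.length, (-1 : R) ^ ((L.length - 1) * t) • d L[t] •
        (((L.rotate t).tail).map (ι R)).prod := by
  rw [contractLeft_prod_map_ι]
  refine Finset.sum_congr rfl fun t _ => ?_
  have ht := t.isLt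
  have h : (L.rotate t).tail = L.drop (t + 1) ++ L.take t := by
    rw [List.rotate_eq_drop_append_take ht.le, List.drop_eq_getElem_cons ht]
    rfl
  rw [h, List.map_append, List.prod_append, prod_map_ι_mul_prod_map_ι (L.take t),
    smul_comm (d L[t]), smul_smul, List.length_take, List.length_drop, min_eq_left ht.le,
    ← pow_add]
  congr 1
  obtain ⟨b, hb⟩ := Nat.exists_eq_add_of_lt ht
  have h₁ : L.length - (t + 1) = b := by omega
  have h₂ : L.length - 1 = t + b := by omega
  rw [h₁, h₂]
  refine neg_one_pow_congr ?_
  simp only [Nat.even_add, Nat.even_mul]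
  tauto

end ListProducts

theorem coe_finRotate_pow_apply {n : ℕ} (t : ℕ) (i : Fin n) :
    (((finRotate n ^ t) i : Fin n) : ℕ) = (i + t) % n := by
  induction t with
  | zero => simp [Nat.mod_eq_of_lt i.isLt]
  | succ t ih =>
    rw [pow_succ', Equiv.Perm.mul_apply]
    cases n with
    | zero => exact i.elim0
    | succ n => rw [finRotate_apply, Fin.val_add, ih, Fin.val_one', Nat.add_mod_mod, Nat.mod_add_mod, add_assoc]

theorem List.tail_rotate_ofFn {α : Type*} {n : ℕ} (f : Fin n → α) (t : ℕ) :
    ((List.ofFn f).rotate t).tail = List.ofFn fun j : Fin (n - 1) =>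
      f ((finRotate n ^ t) ⟨(j : ℕ) + 1, by have := j.isLt; omega⟩) := by
  refine List.ext_getElem (by simp) fun i h₁ h₂ => ?_
  simp only [List.getElem_tail, List.getElem_rotate, List.getElem_ofFn, List.length_ofFn]
  congr 1
  exact Fin.ext (coe_finRotate_pow_apply t ⟨i + 1, _⟩).symm

/-- For a finitely generated projective module `M`, `x ∈ Λ_l(M)`,
`φ₁,…,φ_l ∈ M*` and `m ∈ M`, one has
`e(x, φ₁φ₂⋯φ_l)(m) = Σ_{σ ∈ C_l} sgn(σ) φ_{σ(1)}(m) ((φ_{σ(2)}⋯φ_{σ(l)})·x)`,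
where `C_l` is the cyclic group generated by the cycle `(1,…,l)`, each summand lying
in `Λ₁(M) = M`; here `e(x,ξ)(m) = (m·ξ)·x`, and the equality is read in `Λ(M)`. -/
theorem extE_cyclic_formula
    (R : Type*) [CommRing R] (M : Type*) [AddCommGroup M] [Module R M]
    [Module.Finite R M] [Module.Projective R M] (l : ℕ) (hl : 0 < l)
    (x : ExteriorAlgebra R M) (hx : x ∈ ⋀[R]^l M)
    (φ : Fin l → Module.Dual R M) (m : M) :
    extDelta R M (extDelta' R M (ι R m) ((List.ofFn fun i : Fin l => ι R (φ i)).prod)) x =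
      ∑ t : Fin l,
        (Equiv.Perm.sign ((finRotate l) ^ (t : ℕ)) : ℤ) •
          (φ (((finRotate l) ^ (t : ℕ)) ⟨0, hl⟩) m •
            extDelta R M ((List.ofFn fun j : Fin (l - 1) =>
              ι R (φ (((finRotate l) ^ (t : ℕ))
                ⟨(j : ℕ) + 1, by have := j.isLt; omega⟩))).prod) x) := by
  rw [show (List.ofFn fun i : Fin l => ι R (φ i)) = (List.ofFn φ).map (ι R) by
    rw [List.map_ofFn]; rfl]
  rw [extDelta', lift_ι_apply, LinearMap.comp_apply,
    contractLeft_prod_map_ι_rotate (Module.Dual.eval R M m) (List.ofFn φ), map_sum,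
    LinearMap.sum_apply]
  refine Fintype.sum_equiv (finCongr (by simp)) _ _ fun t => ?_
  have ht : (t : ℕ) < l := by simpa using t.isLt
  have h₀ : (finRotate l ^ (t : ℕ)) ⟨0, hl⟩ = ⟨t, ht⟩ :=
    Fin.ext (by simp [coe_finRotate_pow_apply, Nat.mod_eq_of_lt ht])
  have hs : Equiv.Perm.sign (finRotate l ^ (t : ℕ)) = (-1) ^ ((l - 1) * t) := by
    obtain ⟨n, rfl⟩ := Nat.exists_eq_succ_of_ne_zero hl.ne'
    rw [map_pow, sign_finRotate, ← pow_mul]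
  simp only [finCongr_apply, Fin.val_cast]
  rw [h₀, hs, map_smul, map_smul, LinearMap.smul_apply, LinearMap.smul_apply,
    List.tail_rotate_ofFn, List.map_ofFn, ← Int.cast_smul_eq_zsmul R]
  simp [Function.comp_def]
end

section
/- Let M be a finitely generated projective module over a commutative unital ring k, let x ∈ Λ_l(M) and ξ ∈ Λ_l(M*). Then tr(e(x,ξ)) = l·(ξ·x), where tr is the trace of endomorphisms of the finitely generated projective module M and ξ·x ∈ k is the degree-0 scalar Δ(ξ)(x). -/
open ExteriorAlgebra

/-- The endomorphism `e(x,ξ)` of `M`, `m ↦ (m·ξ)·x`, where the result is viewed in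
`M` via the (partial) inverse `ιInv` of `ι : M → Λ(M)`; for `x ∈ Λ_l(M)` and
`ξ ∈ Λ_l(M*)` the element `(m·ξ)·x` indeed lies in `Λ₁(M) = M`. -/
noncomputable def extE (R : Type*) [CommRing R] (M : Type*) [AddCommGroup M] [Module R M]
    (x : ExteriorAlgebra R M) (ξ : ExteriorAlgebra R (Module.Dual R M)) :
    Module.End R M :=
  ιInv ∘ₗ LinearMap.applyₗ x ∘ₗ (extDelta R M).toLinearMap ∘ₗ
    LinearMap.applyₗ ξ ∘ₗ (extDelta' R M).toLinearMap ∘ₗ ι R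

/-- Pairing a covector with the degree-one part amounts to taking the degree-zero part of the
contraction. -/
theorem ExteriorAlgebra.apply_ιInv {R : Type*} [CommRing R] {M : Type*} [AddCommGroup M]
    [Module R M] (φ : Module.Dual R M) (y : ExteriorAlgebra R M) :
    φ (ιInv y) =
      algebraMapInv (CliffordAlgebra.contractLeft (Q := (0 : QuadraticForm R M)) φ y) := by
  let _ : Module Rᵐᵒᵖ M := Module.compHom _ ((RingHom.id R).fromOpposite mul_comm)
  have : IsCentralScalar R M := ⟨fun r m => rfl⟩
  have hfst (b : ExteriorAlgebra R M) : (toTrivSqZeroExt b).fst = algebraMapInv b := by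
    have h : (TrivSqZeroExt.fstHom R R M).comp (toTrivSqZeroExt (R := R) (M := M)) =
        algebraMapInv := by
      ext m
      simp [algebraMapInv]
    exact DFunLike.congr_fun h b
  have hsnd (b : ExteriorAlgebra R M) : ιInv b = (toTrivSqZeroExt b).snd := rfl
  induction y using CliffordAlgebra.left_induction with
  | algebraMap r =>
    rw [CliffordAlgebra.contractLeft_algebraMap, hsnd]
    erw [AlgHom.commutes toTrivSqZeroExt r]
    simp [TrivSqZeroExt.algebraMap_eq_inl]
  | add y z hy hz => simp only [map_add, hy, hz]
  | ι_mul y m _ =>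
    have hι : algebraMapInv (R := R) (ι R m) = 0 := by simp [algebraMapInv]
    rw [CliffordAlgebra.contractLeft_ι_mul, map_sub, map_smul, hsnd]
    erw [map_mul, map_mul, hι, toTrivSqZeroExt_ι m]
    simp [hfst, mul_comm]

/-- A finite dual basis of a finitely generated projective module. -/
theorem Module.exists_finite_dual_basis (R : Type*) [CommRing R] (M : Type*) [AddCommGroup M]
    [Module R M] [Module.Finite R M] [Module.Projective R M] :
    ∃ (n : ℕ) (e : Fin n → M) (f : Fin n → Module.Dual R M), ∀ m, ∑ i, f i m • e i = m := by
  obtain ⟨n, p, hp⟩ := Module.Finite.exists_fin' R M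
  obtain ⟨s, hs⟩ := Module.projective_lifting_property p LinearMap.id hp
  refine ⟨n, fun i => p (Pi.single i 1), fun i => LinearMap.proj i ∘ₗ s, fun m => ?_⟩
  have h : p (s m) = m := LinearMap.congr_fun hs m
  conv_rhs => rw [← h, pi_eq_sum_univ' (s m), map_sum]
  refine Finset.sum_congr rfl fun i _ => ?_
  rw [map_smul]
  congr 2

/-- Euler's identity: for a finite dual basis, the derivation `∑ i, fᵢ ∧ (eᵢ·_)` of `Λ(M*)`
multiplies elements of degree `l` by `l`. -/
theorem ExteriorAlgebra.sum_ι_mul_contractLeft {R : Type*} [CommRing R] {M : Type*}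
    [AddCommGroup M] [Module R M] {κ : Type*} [Fintype κ] (e : κ → M) (f : κ → Module.Dual R M)
    (hef : ∀ m, ∑ i, f i m • e i = m) (l : ℕ) (ξ : ExteriorAlgebra R (Module.Dual R M))
    (hξ : ξ ∈ ⋀[R]^l (Module.Dual R M)) :
    ∑ i, ι R (f i) * CliffordAlgebra.contractLeft
      (Q := (0 : QuadraticForm R (Module.Dual R M))) (Module.Dual.eval R M (e i)) ξ = l • ξ := by
  induction hξ using Submodule.pow_induction_on_left' with
  | algebraMap r =>
    refine (Finset.sum_eq_zero fun i _ => ?_).trans (zero_smul ℕ _).symm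
    erw [CliffordAlgebra.contractLeft_algebraMap, mul_zero]
  | add x y i _ _ hx hy => simp only [map_add, mul_add, Finset.sum_add_distrib, hx, hy, smul_add]
  | mem_mul m hm j x _ hx =>
    obtain ⟨φ, rfl⟩ := hm
    have hφ : ∑ i, φ (e i) • f i = φ := by
      ext m
      conv_rhs => rw [← hef m]
      simp [mul_comm]
    have h (i : κ) : ι R (f i) * CliffordAlgebra.contractLeft
        (Q := (0 : QuadraticForm R (Module.Dual R M))) (Module.Dual.eval R M (e i)) (ι R φ * x) =
        ι R (φ (e i) • f i) * x + ι R φ * (ι R (f i) * CliffordAlgebra.contractLeft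
          (Q := (0 : QuadraticForm R (Module.Dual R M))) (Module.Dual.eval R M (e i)) x) := by
      have hswap : ι R (f i) * ι R φ = -(ι R φ * ι R (f i)) :=
        eq_neg_of_add_eq_zero_left (ι_add_mul_swap _ _)
      erw [CliffordAlgebra.contractLeft_ι_mul]
      rw [mul_sub, mul_smul_comm, map_smul, smul_mul_assoc, ← mul_assoc, ← mul_assoc]
      erw [hswap]
      rw [neg_mul, sub_neg_eq_add]
      rfl
    simp only [h, Finset.sum_add_distrib, ← Finset.sum_mul, ← map_sum, ← Finset.mul_sum, hφ, hx]
    rw [mul_smul_comm, succ_nsmul']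

/-- For a finitely generated projective module `M`, `x ∈ Λ_l(M)` and
`ξ ∈ Λ_l(M*)`, one has `tr(e(x,ξ)) = l·(ξ·x)`, where `tr` is the trace on `End(M)`
(the unique linear map with `tr(mφ) = φ(m)`) and `ξ·x ∈ k` is the degree-0 scalar
`Δ(ξ)(x)`. -/
theorem trace_extE
    (R : Type*) [CommRing R] (M : Type*) [AddCommGroup M] [Module R M]
    [Module.Finite R M] [Module.Projective R M] (l : ℕ)
    (x : ExteriorAlgebra R M) (hx : x ∈ ⋀[R]^l M)
    (ξ : ExteriorAlgebra R (Module.Dual R M)) (hξ : ξ ∈ ⋀[R]^l (Module.Dual R M))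
    (tr : Module.End R M →ₗ[R] R)
    (htr : ∀ (φ : Module.Dual R M) (v : M), tr (φ.smulRight v) = φ v)
    (c : R) (hc : extDelta R M ξ x = algebraMap R (ExteriorAlgebra R M) c) :
    tr (extE R M x ξ) = l • c := by
  obtain ⟨n, e, f, hef⟩ := Module.exists_finite_dual_basis R M
  have hT (T : Module.End R M) : tr T = ∑ i, f i (T (e i)) := by
    have h : T = ∑ i, (f i).smulRight (T (e i)) := by
      ext m
      conv_lhs => rw [← hef m]
      simp
    conv_lhs => rw [h]
    simp [htr]
  have hterm (i : Fin n) : f i (extE R M x ξ (e i)) =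
      algebraMapInv (extDelta R M (ι R (f i) * CliffordAlgebra.contractLeft
        (Q := (0 : QuadraticForm R (Module.Dual R M))) (Module.Dual.eval R M (e i)) ξ) x) := by
    have h : extE R M x ξ (e i) = ιInv (extDelta R M (CliffordAlgebra.contractLeft
        (Q := (0 : QuadraticForm R (Module.Dual R M))) (Module.Dual.eval R M (e i)) ξ) x) := by
      simp [extE, extDelta']
    rw [h, apply_ιInv, map_mul, Module.End.mul_apply]
    congr 1
    simp [extDelta]
  rw [hT, Finset.sum_congr rfl fun i _ => hterm i, ← map_sum, ← LinearMap.sum_apply, ← map_sum,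
    sum_ι_mul_contractLeft e f hef l ξ hξ, map_nsmul, LinearMap.smul_apply, map_nsmul, hc,
    algebraMap_leftInverse M c]
end
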